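/- arXiv:2406.02954 — 2 statements merged into one kernel-verified Lean document; each statement's English description precedes it below -/
import Mathlib

section
/- Let n ≥ 1 be an integer, let a, q ∈ ℂ with q ≠ 0 and 1 - q^j a ≠ 0 for j = 1, …, n-1, and let ℓ1, ℓ2 be integers. Then (q^{-ℓ2}-q^{-ℓ1})(1-q^{ℓ1}a)(1-q^{ℓ2}a)·F_n(a,q;ℓ1+1,ℓ2+1) + (q^{ℓ1}-q^{-ℓ2})(1-q^{-ℓ1}a)(1-q^{ℓ2}a)·F_n(a,q;ℓ1,ℓ2+1) + (q^{-ℓ1}-q^{ℓ2})(1-q^{ℓ1}a)(1-q^{-ℓ2}a)·F_n(a,q;ℓ1+1,ℓ2) + (q^{ℓ2}-q^{ℓ1})(1-q^{-ℓ1}a)(1-q^{-ℓ2}a)·F_n(a,q;ℓ1,ℓ2) = 0. -/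
open Finset

/-- The q-Pochhammer symbol `(x;q)_k = ∏_{j=0}^{k-1} (1 - x q^j)`. -/
noncomputable def qPoch (x q : ℂ) (k : ℕ) : ℂ := ∏ j ∈ Finset.range k, (1 - x * q ^ j)

/-- The summand `f_k(a,q;ℓ1,ℓ2)`. -/
noncomputable def f (a q : ℂ) (l1 l2 : ℤ) (k : ℕ) : ℂ :=
  qPoch (q ^ l1 * a) q k * qPoch (q ^ (1 - l1) * a) q k *
    qPoch (q ^ l2 * a) q k * qPoch (q ^ (1 - l2) * a) q k * q ^ k /
    (qPoch (q * a) q k) ^ 4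

/-- The truncated sum `F_n(a,q;ℓ1,ℓ2)`. -/
noncomputable def F (n : ℕ) (a q : ℂ) (l1 l2 : ℤ) : ℂ :=
  ∑ k ∈ Finset.range n, f a q l1 l2 k

theorem qPoch_shift (x q : ℂ) (k : ℕ) :
    (1 - x) * qPoch (q * x) q k = qPoch x q k * (1 - x * q ^ k) := by
  rw [qPoch, qPoch, ← prod_range_succ, prod_range_succ', pow_zero, mul_one, mul_comm]
  congr 1
  exact prod_congr rfl fun j _ => by ring

/-- The contiguity relation holds summand by summand. -/
theorem f_contiguous (a q : ℂ) (hq : q ≠ 0) (l1 l2 : ℤ) (k : ℕ) :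
    (q ^ (-l2) - q ^ (-l1)) * (1 - q ^ l1 * a) * (1 - q ^ l2 * a) *
        f a q (l1 + 1) (l2 + 1) k +
      (q ^ l1 - q ^ (-l2)) * (1 - q ^ (-l1) * a) * (1 - q ^ l2 * a) *
        f a q l1 (l2 + 1) k +
      (q ^ (-l1) - q ^ l2) * (1 - q ^ l1 * a) * (1 - q ^ (-l2) * a) *
        f a q (l1 + 1) l2 k +
      (q ^ l2 - q ^ l1) * (1 - q ^ (-l1) * a) * (1 - q ^ (-l2) * a) *
        f a q l1 l2 k = 0 := by
  have up (l : ℤ) : (1 - q ^ l * a) * (qPoch (q ^ (l + 1) * a) q k * qPoch (q ^ (1 - (l + 1)) * a) q k)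
      = qPoch (q ^ l * a) q k * qPoch (q ^ (-l) * a) q k * (1 - q ^ l * a * q ^ k) := by
    have h := qPoch_shift (q ^ l * a) q k
    rw [← mul_assoc, ← zpow_one_add₀ hq, add_comm] at h
    rw [← mul_assoc, h, show 1 - (l + 1) = -l by ring]
    ring
  have down (l : ℤ) : (1 - q ^ (-l) * a) * (qPoch (q ^ l * a) q k * qPoch (q ^ (1 - l) * a) q k)
      = qPoch (q ^ l * a) q k * qPoch (q ^ (-l) * a) q k * (1 - q ^ (-l) * a * q ^ k) := by
    have h := qPoch_shift (q ^ (-l) * a) q k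
    rw [← mul_assoc, ← zpow_one_add₀ hq, ← sub_eq_add_neg] at h
    rw [mul_left_comm, h]
    ring
  have factor (c u v p p' r r' d P R : ℂ) (hp : u * (p * p') = P) (hr : v * (r * r') = R) :
      c * u * v * (p * p' * r * r' * q ^ k / d) = c * P * R * (q ^ k / d) := by
    rw [← hp, ← hr]
    ring
  simp only [f]
  rw [factor _ _ _ _ _ _ _ _ _ _ (up l1) (up l2), factor _ _ _ _ _ _ _ _ _ _ (down l1) (up l2),
    factor _ _ _ _ _ _ _ _ _ _ (up l1) (down l2), factor _ _ _ _ _ _ _ _ _ _ (down l1) (down l2)]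
  have h1 : q ^ l1 * q ^ (-l1) = 1 := by rw [← zpow_add₀ hq, add_neg_cancel, zpow_zero]
  have h2 : q ^ l2 * q ^ (-l2) = 1 := by rw [← zpow_add₀ hq, add_neg_cancel, zpow_zero]
  generalize qPoch (q ^ l1 * a) q k * qPoch (q ^ (-l1) * a) q k = P
  generalize qPoch (q ^ l2 * a) q k * qPoch (q ^ (-l2) * a) q k = R
  generalize q ^ k / qPoch (q * a) q k ^ 4 = D
  generalize q ^ (-l1) = x' at *
  generalize q ^ (-l2) = y' at *
  generalize q ^ l1 = x at *
  generalize q ^ l2 = y at *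
  have hx : x ≠ 0 := left_ne_zero_of_mul_eq_one h1
  have hy : y ≠ 0 := left_ne_zero_of_mul_eq_one h2
  obtain rfl : x' = x⁻¹ := eq_inv_of_mul_eq_one_right h1
  obtain rfl : y' = y⁻¹ := eq_inv_of_mul_eq_one_right h2
  field_simp
  ring

theorem stmt_3 (n : ℕ) (hn : 1 ≤ n) (a q : ℂ) (hq : q ≠ 0)
    (ha : ∀ j : ℕ, 1 ≤ j → j ≤ n - 1 → 1 - q ^ j * a ≠ 0) (l1 l2 : ℤ) :
    (q ^ (-l2) - q ^ (-l1)) * (1 - q ^ l1 * a) * (1 - q ^ l2 * a) *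
        F n a q (l1 + 1) (l2 + 1) +
      (q ^ l1 - q ^ (-l2)) * (1 - q ^ (-l1) * a) * (1 - q ^ l2 * a) *
        F n a q l1 (l2 + 1) +
      (q ^ (-l1) - q ^ l2) * (1 - q ^ l1 * a) * (1 - q ^ (-l2) * a) *
        F n a q (l1 + 1) l2 +
      (q ^ l2 - q ^ l1) * (1 - q ^ (-l1) * a) * (1 - q ^ (-l2) * a) *
        F n a q l1 l2 = 0 := by
  simp only [F, mul_sum, ← sum_add_distrib]
  exact sum_eq_zero fun k _ => f_contiguous a q hq l1 l2 k
end

section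
/- Let n ≥ 1 be an integer, let ζ ∈ ℂ be a primitive nth root of unity, let a ∈ ℂ with a ≠ 0 and a^n ≠ 1, and let ℓ be an integer not divisible by n. Then (1-ζ^ℓ a)·H(a,ζ;ℓ+1) = (a-ζ^ℓ)·H(a,ζ;ℓ), where H(a,ζ;ℓ) = ∑_{k=0}^{n-1} h_k(a,ζ;ℓ). -/
open Finset

/-- The summand `h_k(a,q;ℓ)`. -/
noncomputable def h (a q : ℂ) (l : ℤ) (k : ℕ) : ℂ :=
  (1 - a) * qPoch (q ^ l * a) q k * qPoch (q ^ (1 - l) * a) q k * q ^ k /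
    ((1 - q ^ k * a) * (qPoch (q * a) q k) ^ 2)

/-- The sum `H(a,q;ℓ) = ∑_{k=0}^{n-1} h_k(a,q;ℓ)`. -/
noncomputable def H (n : ℕ) (a q : ℂ) (l : ℤ) : ℂ :=
  ∑ k ∈ Finset.range n, h a q l k

lemma qPoch_succ (x q : ℂ) (k : ℕ) : qPoch x q (k + 1) = qPoch x q k * (1 - x * q ^ k) :=
  Finset.prod_range_succ _ _

lemma qPoch_mul_one_sub (x q : ℂ) (k : ℕ) :
    qPoch x q k * (1 - x * q ^ k) = (1 - x) * qPoch (q * x) q k := by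
  rw [← qPoch_succ, qPoch, Finset.prod_range_succ', mul_comm]
  simp only [pow_zero, mul_one, qPoch]
  congr 1
  exact Finset.prod_congr rfl fun j _ => by ring

/-- If `q ^ n = 1`, shifting the argument by a power of `q` does not change `(x;q)_n`. -/
lemma qPoch_zpow_mul {n : ℕ} {a q : ℂ} (hq0 : q ≠ 0) (hq : q ^ n = 1)
    (h1 : ∀ m : ℤ, 1 - q ^ m * a ≠ 0) (m : ℤ) : qPoch (q ^ m * a) q n = qPoch a q n := by
  have step (m : ℤ) : qPoch (q ^ m * a) q n = qPoch (q ^ (m + 1) * a) q n := by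
    have h2 := qPoch_mul_one_sub (q ^ m * a) q n
    rw [hq, mul_one, mul_comm, ← mul_assoc, mul_comm q, ← zpow_add_one₀ hq0] at h2
    exact mul_left_cancel₀ (h1 m) h2
  induction m using Int.induction_on with
  | zero => simp
  | succ i ih => rw [← step, ih]
  | pred i ih => rw [step, sub_add_cancel, ih]

/-- A telescoping sum: it vanishes when `(xa;q)_n (ya;q)_n = (a;q)_n ^ 2`. -/
lemma sum_qPoch_eq_zero {n : ℕ} {a q x y : ℂ} (hxy : x * y = 1) (hx : x ≠ 1) (ha0 : a ≠ 0)
    (ha1 : 1 - a ≠ 0) (hu : ∀ k : ℕ, 1 - a * q ^ k ≠ 0)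
    (hn : qPoch (x * a) q n * qPoch (y * a) q n = qPoch a q n ^ 2) :
    ∑ k ∈ Finset.range n,
      qPoch (x * a) q k * qPoch (y * a) q k * q ^ k / qPoch (q * a) q k ^ 2 = 0 := by
  have hA (k : ℕ) : qPoch a q k ≠ 0 := Finset.prod_ne_zero_iff.mpr fun j _ => hu j
  have key (k : ℕ) : -a * (x - 1) ^ 2 * y *
      (qPoch (x * a) q k * qPoch (y * a) q k * q ^ k / qPoch (q * a) q k ^ 2) =
      (1 - a) ^ 2 * (qPoch (x * a) q (k + 1) * qPoch (y * a) q (k + 1) / qPoch a q (k + 1) ^ 2) -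
        (1 - a) ^ 2 * (qPoch (x * a) q k * qPoch (y * a) q k / qPoch a q k ^ 2) := by
    have hR : qPoch (q * a) q k = qPoch a q k * (1 - a * q ^ k) / (1 - a) := by
      rw [qPoch_mul_one_sub, mul_div_cancel_left₀ _ ha1]
    have h1 := hA k
    have h2 := hu k
    rw [hR, qPoch_succ, qPoch_succ, qPoch_succ]
    generalize qPoch (x * a) q k = P
    generalize qPoch (y * a) q k = Q
    field_simp
    linear_combination P * Q * (a * q ^ k * (2 - x) - a ^ 2 * q ^ (2 * k)) * hxy
  have hy : y ≠ 0 := right_ne_zero_of_mul_eq_one hxy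
  have hc : -a * (x - 1) ^ 2 * y ≠ 0 :=
    mul_ne_zero (mul_ne_zero (neg_ne_zero.mpr ha0) (pow_ne_zero _ (sub_ne_zero.mpr hx))) hy
  refine (mul_eq_zero.mp ?_).resolve_left hc
  rw [Finset.mul_sum, Finset.sum_congr rfl fun k _ => key k,
    Finset.sum_range_sub fun k =>
      (1 - a) ^ 2 * (qPoch (x * a) q k * qPoch (y * a) q k / qPoch a q k ^ 2),
    hn, div_self (pow_ne_zero 2 (hA n))]
  simp [qPoch]

/-- The contiguous relation for the summands, in which the factor `1 - q ^ k * a` cancels. -/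
lemma h_contiguous {a q : ℂ} (hq0 : q ≠ 0) (l : ℤ) (k : ℕ) (hu : 1 - q ^ k * a ≠ 0) :
    (1 - q ^ l * a) * h a q (l + 1) k - (a - q ^ l) * h a q l k =
      (1 - a) * (1 + q ^ l) *
        (qPoch (q ^ l * a) q k * qPoch (q ^ (-l) * a) q k * q ^ k / qPoch (q * a) q k ^ 2) := by
  have hP := qPoch_mul_one_sub (q ^ l * a) q k
  have hQ := qPoch_mul_one_sub (q ^ (-l) * a) q k
  have hxy : q ^ l * q ^ (-l) = 1 := by rw [← zpow_add₀ hq0, add_neg_cancel, zpow_zero]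
  rw [← mul_assoc q] at hP hQ
  simp only [h, show (1 : ℤ) - (l + 1) = -l by ring, zpow_add₀ hq0 l 1, sub_eq_add_neg (1 : ℤ) l,
    zpow_add₀ hq0 1 (-l), zpow_one, mul_comm (q ^ l) q]
  generalize qPoch (q * q ^ l * a) q k = P₁ at *
  generalize qPoch (q * q ^ (-l) * a) q k = Q₁ at *
  generalize qPoch (q ^ l * a) q k = P at *
  generalize qPoch (q ^ (-l) * a) q k = Q at *
  generalize q ^ l = x at *
  generalize q ^ (-l) = y at *
  generalize qPoch (q * a) q k = R
  generalize q ^ k = u at *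
  have core : (1 - x * a) * P₁ * Q - (a - x) * P * Q₁ = (1 + x) * P * Q * (1 - u * a) := by
    linear_combination (-Q) * hP - x * P * hQ + a * P * (Q₁ - u * Q) * hxy
  calc _ = (1 - a) * u * ((1 - x * a) * P₁ * Q - (a - x) * P * Q₁) / ((1 - u * a) * R ^ 2) := by
        ring
    _ = _ := by
        rw [core, mul_comm ((1 + x) * P * Q), ← mul_assoc, mul_comm ((1 - a) * u), mul_assoc,
          mul_div_mul_left _ _ hu]
        ring

theorem stmt_7 (n : ℕ) (hn : 1 ≤ n) (ζ : ℂ) (hζ : IsPrimitiveRoot ζ n)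
    (a : ℂ) (ha0 : a ≠ 0) (ha : a ^ n ≠ 1) (l : ℤ) (hl : ¬ (n : ℤ) ∣ l) :
    (1 - ζ ^ l * a) * H n a ζ (l + 1) = (a - ζ ^ l) * H n a ζ l := by
  have hq0 : ζ ≠ 0 := hζ.ne_zero (by omega)
  have h1 (m : ℤ) : 1 - ζ ^ m * a ≠ 0 := by
    intro hm
    apply ha
    have h2 : (ζ ^ m) ^ n = 1 := by
      rw [← zpow_natCast, zpow_comm, zpow_natCast, hζ.pow_eq_one, one_zpow]
    rw [← one_mul (a ^ n), ← h2, ← mul_pow, ← sub_eq_zero.mp hm, one_pow, h2]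
  have hu (k : ℕ) : 1 - ζ ^ k * a ≠ 0 := by simpa using h1 k
  rw [← sub_eq_zero, H, H, Finset.mul_sum, Finset.mul_sum, ← Finset.sum_sub_distrib,
    Finset.sum_congr rfl fun k _ => h_contiguous hq0 l k (hu k), ← Finset.mul_sum,
    sum_qPoch_eq_zero, mul_zero]
  · rw [← zpow_add₀ hq0, add_neg_cancel, zpow_zero]
  · rwa [Ne, hζ.zpow_eq_one_iff_dvd]
  · exact ha0
  · simpa using h1 0
  · intro k
    rw [mul_comm]
    exact hu k
  · rw [qPoch_zpow_mul hq0 hζ.pow_eq_one h1, qPoch_zpow_mul hq0 hζ.pow_eq_one h1, sq]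
end
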